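/- arXiv:1602.07090 — 2 statements merged into one kernel-verified Lean document; each statement's English description precedes it below -/
import Mathlib

section
/- Let K be a compact Hausdorff space and X a Banach space. Then C(K, X), the space of continuous X-valued functions on K with the supremum norm, is almost square if and only if X is almost square. -/
open Filter Topology

noncomputable section

/-- A Banach space is octahedral (OH). -/
def IsOctahedral (Z : Type*) [NormedAddCommGroup Z] : Prop :=
  ∀ (n : ℕ) (z : Fin n → Z), (∀ i, ‖z i‖ = 1) → ∀ ε : ℝ, 0 < ε →
    ∃ w : Z, ‖w‖ = 1 ∧ ∀ i, ‖z i + w‖ > 2 - ε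

/-- Locally octahedral (LOH). -/
def IsLocallyOctahedral (Z : Type*) [NormedAddCommGroup Z] : Prop :=
  ∀ z : Z, ‖z‖ = 1 → ∀ ε : ℝ, 0 < ε →
    ∃ w : Z, ‖w‖ = 1 ∧ ‖z + w‖ > 2 - ε ∧ ‖z - w‖ > 2 - ε

/-- Weakly octahedral (WOH). -/
def IsWeaklyOctahedral (X : Type*) [NormedAddCommGroup X] [NormedSpace ℝ X] : Prop :=
  ∀ (n : ℕ) (z : Fin n → X), (∀ i, ‖z i‖ = 1) → ∀ f : X →L[ℝ] ℝ, ‖f‖ ≤ 1 →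
    ∀ ε : ℝ, 0 < ε → ∃ y : X, ‖y‖ = 1 ∧ ∀ i, ∀ t : ℝ, 0 < t →
      ‖z i + t • y‖ ≥ (1 - ε) * (|f (z i)| + t) ∧
      ‖z i - t • y‖ ≥ (1 - ε) * (|f (z i)| + t)

/-- Almost square (ASQ), sequential formulation. -/
def IsASQ (Z : Type*) [NormedAddCommGroup Z] : Prop :=
  ∀ (n : ℕ) (z : Fin n → Z), (∀ i, ‖z i‖ = 1) →
    ∃ w : ℕ → Z, (∀ k, ‖w k‖ ≤ 1) ∧
      Tendsto (fun k => ‖w k‖) atTop (nhds 1) ∧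
      ∀ i, Tendsto (fun k => ‖z i + w k‖) atTop (nhds 1) ∧
           Tendsto (fun k => ‖z i - w k‖) atTop (nhds 1)

/-- Almost square (ASQ), finite-ε formulation. -/
def IsASQeps (Z : Type*) [NormedAddCommGroup Z] : Prop :=
  ∀ (n : ℕ) (z : Fin n → Z), (∀ i, ‖z i‖ = 1) → ∀ ε : ℝ, 0 < ε →
    ∃ w : Z, ‖w‖ = 1 ∧ ∀ i, ‖z i + w‖ ≤ 1 + ε ∧ ‖z i - w‖ ≤ 1 + ε

/-- Locally almost square (LASQ), sequential formulation. -/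
def IsLASQ (Z : Type*) [NormedAddCommGroup Z] : Prop :=
  ∀ z : Z, ‖z‖ = 1 →
    ∃ w : ℕ → Z, (∀ k, ‖w k‖ ≤ 1) ∧
      Tendsto (fun k => ‖w k‖) atTop (nhds 1) ∧
      Tendsto (fun k => ‖z + w k‖) atTop (nhds 1) ∧
      Tendsto (fun k => ‖z - w k‖) atTop (nhds 1)

/-- Locally almost square (LASQ), ε formulation. -/
def IsLASQeps (Z : Type*) [NormedAddCommGroup Z] : Prop :=
  ∀ z : Z, ‖z‖ = 1 → ∀ ε : ℝ, 0 < ε →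
    ∃ w : Z, ‖w‖ = 1 ∧ ‖z + w‖ ≤ 1 + ε ∧ ‖z - w‖ ≤ 1 + ε

/-- Weakly almost square (WASQ). -/
def IsWASQ (Z : Type*) [NormedAddCommGroup Z] [NormedSpace ℝ Z] : Prop :=
  ∀ z : Z, ‖z‖ = 1 →
    ∃ w : ℕ → Z, (∀ k, ‖w k‖ ≤ 1) ∧
      Tendsto (fun k => ‖w k‖) atTop (nhds 1) ∧
      Tendsto (fun k => ‖z + w k‖) atTop (nhds 1) ∧
      Tendsto (fun k => ‖z - w k‖) atTop (nhds 1) ∧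
      ∀ f : Z →L[ℝ] ℝ, Tendsto (fun k => f (w k)) atTop (nhds 0)

/-- Local diameter two property: every slice of the unit ball has diameter two. -/
def HasLD2P (Z : Type*) [NormedAddCommGroup Z] [NormedSpace ℝ Z] : Prop :=
  ∀ f : Z →L[ℝ] ℝ, ‖f‖ = 1 → ∀ α : ℝ, 0 < α →
    Metric.diam {x : Z | ‖x‖ ≤ 1 ∧ 1 - α < f x} = 2

/-- Diameter two property: every nonempty relatively weakly open subset of the unit
ball has diameter two. -/
def HasD2P (Z : Type*) [NormedAddCommGroup Z] [NormedSpace ℝ Z] : Prop :=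
  ∀ U : Set Z, U.Nonempty → (∀ x ∈ U, ‖x‖ ≤ 1) →
    (∀ x ∈ U, ∃ (n : ℕ) (f : Fin n → Z →L[ℝ] ℝ) (δ : ℝ), 0 < δ ∧
      {y : Z | ‖y‖ ≤ 1 ∧ ∀ i, |f i y - f i x| < δ} ⊆ U) →
    Metric.diam U = 2

/-- The Schur property. -/
def HasSchurProperty (Z : Type*) [SeminormedAddCommGroup Z] [NormedSpace ℝ Z] : Prop :=
  ∀ (u : ℕ → Z) (x : Z),
    (∀ f : Z →L[ℝ] ℝ, Tendsto (fun k => f (u k)) atTop (nhds (f x))) →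
    Tendsto (fun k => ‖u k - x‖) atTop (nhds 0)

/-- The Dunford–Pettis property: every weakly compact operator is
weak-to-norm sequentially continuous. -/
def HasDPP (X : Type*) [NormedAddCommGroup X] [NormedSpace ℝ X] : Prop :=
  ∀ (Y : Type) (_ : NormedAddCommGroup Y) (_ : NormedSpace ℝ Y) (_ : CompleteSpace Y)
    (T : X →L[ℝ] Y),
    (∃ K : Set (WeakSpace ℝ Y), IsCompact K ∧
      ∀ x : X, ‖x‖ ≤ 1 → toWeakSpace ℝ Y (T x) ∈ K) →
    ∀ (u : ℕ → X) (x : X),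
      (∀ f : X →L[ℝ] ℝ, Tendsto (fun k => f (u k)) atTop (nhds (f x))) →
      Tendsto (fun k => ‖T (u k) - T x‖) atTop (nhds 0)

/-- `Z`, together with the bilinear-type map `t`, is (a realization of) the injective
tensor product `X ⊗̂_ε Y`: the span of elementary tensors is dense and the norm of any
linear combination of elementary tensors is given by the injective tensor norm. -/
def IsInjTensorProduct (X Y Z : Type*) [NormedAddCommGroup X] [NormedSpace ℝ X]
    [NormedAddCommGroup Y] [NormedSpace ℝ Y] [NormedAddCommGroup Z] [NormedSpace ℝ Z]
    (t : X → Y → Z) : Prop :=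
  (Submodule.span ℝ (Set.range fun p : X × Y => t p.1 p.2)).topologicalClosure = ⊤ ∧
  ∀ l : List (X × Y),
    ‖(l.map fun p => t p.1 p.2).sum‖ =
      sSup {s : ℝ | ∃ (f : X →L[ℝ] ℝ) (g : Y →L[ℝ] ℝ), ‖f‖ ≤ 1 ∧ ‖g‖ ≤ 1 ∧
        s = |(l.map fun p => f p.1 * g p.2).sum|}

/-- `Z`, together with the map `t`, is (a realization of) the projective tensor product
`X ⊗̂_π Y`: the span of elementary tensors is dense and the norm of any combination of
elementary tensors is the infimum of `Σ ‖xᵢ‖‖yᵢ‖` over all representations (two formal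
combinations represent the same tensor iff they agree against all pairs of functionals). -/
def IsProjTensorProduct (X Y Z : Type*) [NormedAddCommGroup X] [NormedSpace ℝ X]
    [NormedAddCommGroup Y] [NormedSpace ℝ Y] [NormedAddCommGroup Z] [NormedSpace ℝ Z]
    (t : X → Y → Z) : Prop :=
  (Submodule.span ℝ (Set.range fun p : X × Y => t p.1 p.2)).topologicalClosure = ⊤ ∧
  ∀ l : List (X × Y),
    ‖(l.map fun p => t p.1 p.2).sum‖ =
      sInf {s : ℝ | ∃ l' : List (X × Y),
        (∀ (f : X →L[ℝ] ℝ) (g : Y →L[ℝ] ℝ),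
          (l'.map fun p => f p.1 * g p.2).sum = (l.map fun p => f p.1 * g p.2).sum) ∧
        s = (l'.map fun p => ‖p.1‖ * ‖p.2‖).sum}

/-- `Z`, together with the diagonal map `δ : x ↦ x^N`, is (a realization of) the `N`-fold
injective symmetric tensor product `⊗̂_{ε,s,N} X`. -/
def IsInjSymTensorProduct (X : Type*) [NormedAddCommGroup X] [NormedSpace ℝ X] (N : ℕ)
    (Z : Type*) [NormedAddCommGroup Z] [NormedSpace ℝ Z] (δ : X → Z) : Prop :=
  (Submodule.span ℝ (Set.range δ)).topologicalClosure = ⊤ ∧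
  ∀ l : List (ℝ × X),
    ‖(l.map fun p => p.1 • δ p.2).sum‖ =
      sSup {s : ℝ | ∃ f : X →L[ℝ] ℝ, ‖f‖ ≤ 1 ∧
        s = |(l.map fun p => p.1 * (f p.2) ^ N).sum|}

/-- `Z`, together with the diagonal map `δ : x ↦ x^N`, is (a realization of) the `N`-fold
projective symmetric tensor product `⊗̂_{π,s,N} X`. -/
def IsProjSymTensorProduct (X : Type*) [NormedAddCommGroup X] [NormedSpace ℝ X] (N : ℕ)
    (Z : Type*) [NormedAddCommGroup Z] [NormedSpace ℝ Z] (δ : X → Z) : Prop :=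
  (Submodule.span ℝ (Set.range δ)).topologicalClosure = ⊤ ∧
  ∀ l : List (ℝ × X),
    ‖(l.map fun p => p.1 • δ p.2).sum‖ =
      sInf {s : ℝ | ∃ l' : List (ℝ × X),
        (∀ f : X →L[ℝ] ℝ,
          (l'.map fun p => p.1 * (f p.2) ^ N).sum = (l.map fun p => p.1 * (f p.2) ^ N).sum) ∧
        s = (l'.map fun p => |p.1| * ‖p.2‖ ^ N).sum}

/-- An operator `T : X* → Y` is weak*-to-weakly continuous. -/
def WeakStarToWeakContinuous {X Y : Type*} [NormedAddCommGroup X] [NormedSpace ℝ X]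
    [NormedAddCommGroup Y] [NormedSpace ℝ Y] (T : (X →L[ℝ] ℝ) →L[ℝ] Y) : Prop :=
  ∀ g : Y →L[ℝ] ℝ, Continuous fun f : WeakDual ℝ X => g (T f)

/-- The elementary tensor `x ⊗ y` regarded as the operator `x* ↦ x*(x) • y` in `L(X*, Y)`. -/
def elemTensor {X Y : Type*} [NormedAddCommGroup X] [NormedSpace ℝ X]
    [NormedAddCommGroup Y] [NormedSpace ℝ Y] (x : X) (y : Y) : (X →L[ℝ] ℝ) →L[ℝ] Y :=
  (ContinuousLinearMap.apply ℝ ℝ x).smulRight y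

/-- `n(Z, u) = 1`, i.e. `D(Z,u) = {f ∈ B_{Z*} : f(u) = 1}` is a norming set for `Z`. -/
def NormOneUnitary (Z : Type*) [NormedAddCommGroup Z] [NormedSpace ℝ Z] (u : Z) : Prop :=
  ‖u‖ = 1 ∧ ∀ z : Z, ‖z‖ ≤ sSup {r : ℝ | ∃ g : Z →L[ℝ] ℝ, ‖g‖ ≤ 1 ∧ g u = 1 ∧ r = |g z|}

/-- Asplund space: every closed separable subspace has separable dual. -/
def IsAsplund (Y : Type*) [NormedAddCommGroup Y] [NormedSpace ℝ Y] : Prop :=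
  ∀ S : Submodule ℝ Y, IsClosed (S : Set Y) → TopologicalSpace.SeparableSpace S →
    TopologicalSpace.SeparableSpace ((↥S) →L[ℝ] ℝ)

/-- The (metric) approximation-type property: finite-rank operators approximate the
identity uniformly on compact sets. -/
def HasAP (E : Type*) [NormedAddCommGroup E] [NormedSpace ℝ E] : Prop :=
  ∀ K : Set E, IsCompact K → ∀ ε : ℝ, 0 < ε →
    ∃ T : E →L[ℝ] E, FiniteDimensional ℝ (LinearMap.range (T : E →ₗ[ℝ] E)) ∧
      ∀ x ∈ K, ‖T x - x‖ ≤ ε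

end

/-- In an ASQ space the almost-square direction also works for finite subsets of the ball. -/
theorem asq_ball_aux {X : Type*} [NormedAddCommGroup X] [NormedSpace ℝ X] (h : IsASQeps X)
    (t : Set X) (ht : t.Finite) (hb : ∀ y ∈ t, ‖y‖ ≤ 1) (ε : ℝ) (hε : 0 < ε) :
    ∃ w : X, ‖w‖ = 1 ∧ ∀ y ∈ t, ‖y + w‖ ≤ 1 + ε ∧ ‖y - w‖ ≤ 1 + ε := by
  obtain ⟨u0, hu0, -⟩ := h 0 (fun i => i.elim0) (fun i => i.elim0) 1 one_pos
  have hu : ∀ y : X, ∃ u : X, ‖u‖ = 1 ∧ y = ‖y‖ • u := by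
    intro y
    by_cases hy : y = 0
    · exact ⟨u0, hu0, by simp [hy]⟩
    · have hy' : ‖y‖ ≠ 0 := norm_ne_zero_iff.mpr hy
      refine ⟨‖y‖⁻¹ • y, ?_, ?_⟩
      · rw [norm_smul, norm_inv, norm_norm, inv_mul_cancel₀ hy']
      · rw [smul_smul, mul_inv_cancel₀ hy', one_smul]
  choose u hu1 hu2 using hu
  obtain ⟨n, f, hf⟩ := ht.fin_param
  obtain ⟨hinj, hr⟩ := hf
  obtain ⟨w, hw, hw2⟩ := h n (fun i => u (f i)) (fun i => hu1 _) ε hε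
  have key : ∀ (y v : X), ‖y‖ ≤ 1 → ‖v‖ = 1 → ‖u y + v‖ ≤ 1 + ε → ‖y + v‖ ≤ 1 + ε := by
    intro y v hy hv huv
    have e : y + v = ‖y‖ • (u y + v) + (1 - ‖y‖) • v := by
      rw [smul_add, ← hu2 y, sub_smul, one_smul]; abel
    rw [e]
    refine (norm_add_le _ _).trans ?_
    rw [norm_smul, norm_smul, norm_norm, hv, Real.norm_of_nonneg (by linarith)]
    nlinarith [mul_le_mul_of_nonneg_left huv (norm_nonneg y)]
  refine ⟨w, hw, fun y hy => ?_⟩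
  obtain ⟨i, rfl⟩ : y ∈ Set.range f := hr ▸ hy
  refine ⟨key _ _ (hb _ hy) hw (hw2 i).1, ?_⟩
  rw [sub_eq_add_neg]
  exact key _ _ (hb _ hy) (by rwa [norm_neg]) (by rw [← sub_eq_add_neg]; exact (hw2 i).2)

theorem statement6 (K : Type*) [TopologicalSpace K] [CompactSpace K] [T2Space K] [Nonempty K]
    (X : Type*) [NormedAddCommGroup X] [NormedSpace ℝ X] [CompleteSpace X] :
    IsASQeps C(K, X) ↔ IsASQeps X := by
  constructor
  · intro h n z hz ε hε
    obtain ⟨w, hw, hw2⟩ := h n (fun i => ContinuousMap.const K (z i))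
      (fun i => by
        refine le_antisymm ((ContinuousMap.norm_le _ zero_le_one).2 fun _ => (hz i).le) ?_
        obtain ⟨k⟩ := ‹Nonempty K›
        have := (ContinuousMap.const K (z i)).norm_coe_le_norm k
        rw [ContinuousMap.const_apply, hz i] at this
        exact this) ε hε
    obtain ⟨k, -, hk⟩ := isCompact_univ.exists_isMaxOn (Set.univ_nonempty (α := K))
      (w.continuous.norm.continuousOn)
    refine ⟨w k, ?_, fun i => ⟨?_, ?_⟩⟩
    · refine le_antisymm (hw ▸ w.norm_coe_le_norm k) ?_
      rw [← hw]
      exact (ContinuousMap.norm_le _ (norm_nonneg _)).2 fun x => hk (Set.mem_univ x)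
    · exact (ContinuousMap.norm_coe_le_norm _ k).trans (hw2 i).1
    · exact (ContinuousMap.norm_coe_le_norm _ k).trans (hw2 i).2
  · intro h n z hz ε hε
    have hC : IsCompact (⋃ i, Set.range (z i)) :=
      isCompact_iUnion fun i => isCompact_range (z i).continuous
    obtain ⟨t, htC, htf, hcov⟩ := hC.finite_cover_balls (half_pos hε)
    have hb : ∀ y ∈ t, ‖y‖ ≤ 1 := by
      intro y hy
      obtain ⟨i, k, rfl⟩ := Set.mem_iUnion.1 (htC hy)
      exact hz i ▸ (z i).norm_coe_le_norm k
    obtain ⟨w, hw, hw2⟩ := asq_ball_aux h t htf hb (ε / 2) (half_pos hε)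
    have near : ∀ i k, ∃ y ∈ t, ‖z i k - y‖ ≤ ε / 2 := by
      intro i k
      have := hcov (Set.mem_iUnion.2 ⟨i, k, rfl⟩)
      simp only [Set.mem_iUnion, Metric.mem_ball, dist_eq_norm] at this
      obtain ⟨y, hy, hd⟩ := this
      exact ⟨y, hy, hd.le⟩
    refine ⟨ContinuousMap.const K w, ?_, fun i => ⟨?_, ?_⟩⟩
    · refine le_antisymm ((ContinuousMap.norm_le _ zero_le_one).2 fun _ => hw.le) ?_
      obtain ⟨k⟩ := ‹Nonempty K›
      have := (ContinuousMap.const K w).norm_coe_le_norm k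
      rw [ContinuousMap.const_apply, hw] at this
      exact this
    · refine (ContinuousMap.norm_le _ (by linarith)).2 fun k => ?_
      obtain ⟨y, hy, hd⟩ := near i k
      have e : z i k + w = (z i k - y) + (y + w) := by abel
      change ‖z i k + w‖ ≤ _
      rw [e]
      linarith [norm_add_le (z i k - y) (y + w), (hw2 y hy).1]
    · refine (ContinuousMap.norm_le _ (by linarith)).2 fun k => ?_
      obtain ⟨y, hy, hd⟩ := near i k
      have e : z i k - w = (z i k - y) + (y - w) := by abel
      change ‖z i k - w‖ ≤ _
      rw [e]
      linarith [norm_add_le (z i k - y) (y - w), (hw2 y hy).2]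
end

section
/- Let X be a Banach space with the Dunford–Pettis property. If X is weakly almost square, then for each N ∈ ℕ the space P(^N X) of continuous N-homogeneous polynomials on X is locally octahedral; equivalently, the N-fold projective symmetric tensor product ⊗̂_{π,s,N} X has the local diameter two property. -/
open Filter Topology

/-- Evaluation at `x`, as a function on the dual. -/
def evF {X : Type*} [NormedAddCommGroup X] [NormedSpace ℝ X] (x : X) : (X →L[ℝ] ℝ) → ℝ :=
  fun f => f x

theorem exists_coeffs (N : ℕ) : ∃ c : ℕ → ℕ → ℝ, ∀ a : ℕ → ℝ, ∀ j ∈ Finset.range (N + 1),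
    ∑ i ∈ Finset.range (N + 1), c j i * ∑ k ∈ Finset.range (N + 1), (i : ℝ) ^ k * a k = a j := by
  classical
  refine ⟨fun j i => (Lagrange.basis (Finset.range (N + 1)) (fun i : ℕ => (i : ℝ)) i).coeff j, ?_⟩
  intro a j hj
  set p : Polynomial ℝ := ∑ k ∈ Finset.range (N + 1), Polynomial.C (a k) * Polynomial.X ^ k with hp
  have hdeg : p.degree < (Finset.range (N + 1)).card := by
    rw [Finset.card_range, Polynomial.degree_lt_iff_coeff_zero]
    intro m hm
    rw [hp, Polynomial.finsetSum_coeff]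
    refine Finset.sum_eq_zero fun k hk => ?_
    rw [Polynomial.coeff_C_mul_X_pow, if_neg]
    have := Finset.mem_range.1 hk
    omega
  have hinj : Set.InjOn (fun i : ℕ => (i : ℝ)) (Finset.range (N + 1) : Set ℕ) := by
    intro x _ y _ h
    exact Nat.cast_injective h
  have h := Lagrange.eq_interpolate hinj hdeg
  have hc : p.coeff j = a j := by
    rw [hp, Polynomial.finsetSum_coeff, Finset.sum_eq_single j]
    · simp
    · intro b _ hb
      rw [Polynomial.coeff_C_mul_X_pow, if_neg (Ne.symm hb)]
    · intro h; exact absurd hj h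
  rw [← hc]
  conv_rhs => rw [h, Lagrange.interpolate_apply, Polynomial.finsetSum_coeff]
  refine Finset.sum_congr rfl fun i _ => ?_
  rw [Polynomial.coeff_C_mul, mul_comm]
  congr 1
  rw [hp, Polynomial.eval_finsetSum]
  refine Finset.sum_congr rfl fun k _ => ?_
  rw [Polynomial.eval_mul, Polynomial.eval_C, Polynomial.eval_pow, Polynomial.eval_X, mul_comm]

section
variable {X : Type*} [NormedAddCommGroup X] [NormedSpace ℝ X]

theorem evF_add (x y : X) : evF (x + y) = evF x + evF y := by
  funext f; simp [evF]

theorem evF_smul (t : ℝ) (x : X) : evF (t • x) = t • evF x := by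
  funext f; simp [evF]

theorem L_smul (L : ((X →L[ℝ] ℝ) → ℝ) →ₗ[ℝ] ℝ) (N : ℕ) (t : ℝ) (x : X) :
    L (evF (t • x) ^ N) = t ^ N * L (evF x ^ N) := by
  rw [evF_smul, smul_pow, map_smul, smul_eq_mul]

theorem L_expand (L : ((X →L[ℝ] ℝ) → ℝ) →ₗ[ℝ] ℝ) (N : ℕ) (t : ℝ) (x y : X) :
    L (evF (x + t • y) ^ N) =
      ∑ k ∈ Finset.range (N + 1), t ^ k * ((N.choose k : ℝ) * L (evF x ^ (N - k) * evF y ^ k)) := by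
  rw [evF_add, evF_smul, add_comm, add_pow, map_sum]
  refine Finset.sum_congr rfl fun k _ => ?_
  have : (t • evF y) ^ k * evF x ^ (N - k) * (N.choose k : (X →L[ℝ] ℝ) → ℝ)
      = (t ^ k * (N.choose k : ℝ)) • (evF x ^ (N - k) * evF y ^ k) := by
    funext f
    simp
    ring
  rw [this, map_smul, smul_eq_mul]; ring

theorem mixed_bound (L : ((X →L[ℝ] ℝ) → ℝ) →ₗ[ℝ] ℝ) (N : ℕ) (C : ℝ)
    (hL : ∀ x : X, ‖x‖ ≤ 1 → |L (evF x ^ N)| ≤ C) (j : ℕ) (hj : j ≤ N) :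
    ∃ C' : ℝ, 0 ≤ C' ∧ ∀ x y : X, ‖x‖ ≤ 1 → ‖y‖ ≤ 1 → |L (evF x ^ (N - j) * evF y ^ j)| ≤ C' := by
  obtain ⟨c, hc⟩ := exists_coeffs N
  have hC : 0 ≤ C := (abs_nonneg _).trans (hL 0 (by simp))
  have hbig : ∀ x : X, ‖x‖ ≤ (N : ℝ) + 1 → |L (evF x ^ N)| ≤ ((N : ℝ) + 1) ^ N * C := by
    intro x hx
    have hp : (0 : ℝ) < (N : ℝ) + 1 := by positivity
    have h1 : x = ((N : ℝ) + 1) • (((N : ℝ) + 1)⁻¹ • x) := by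
      rw [smul_smul, mul_inv_cancel₀ hp.ne', one_smul]
    rw [h1, L_smul, abs_mul, abs_of_nonneg (by positivity : (0 : ℝ) ≤ ((N : ℝ) + 1) ^ N)]
    gcongr
    apply hL
    rw [norm_smul, norm_inv, Real.norm_of_nonneg hp.le, inv_mul_le_iff₀ hp]
    simpa using hx
  refine ⟨∑ i ∈ Finset.range (N + 1), |c j i| * (((N : ℝ) + 1) ^ N * C), by positivity, ?_⟩
  intro x y hx hy
  have key := hc (fun k => (N.choose k : ℝ) * L (evF x ^ (N - k) * evF y ^ k)) j
    (Finset.mem_range.2 (by omega))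
  have h1 : (1 : ℝ) ≤ N.choose j := by exact_mod_cast Nat.choose_pos hj
  calc |L (evF x ^ (N - j) * evF y ^ j)|
      ≤ (N.choose j : ℝ) * |L (evF x ^ (N - j) * evF y ^ j)| := by
        nlinarith [abs_nonneg (L (evF x ^ (N - j) * evF y ^ j))]
    _ = |(N.choose j : ℝ) * L (evF x ^ (N - j) * evF y ^ j)| := by
        rw [abs_mul, abs_of_nonneg (by linarith : (0 : ℝ) ≤ (N.choose j : ℝ))]
    _ ≤ _ := by
        rw [← key]
        refine (Finset.abs_sum_le_sum_abs _ _).trans (Finset.sum_le_sum fun i hi => ?_)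
        rw [abs_mul, ← L_expand]
        gcongr
        apply hbig
        have hi' : (i : ℝ) ≤ N := by exact_mod_cast Nat.lt_succ_iff.1 (Finset.mem_range.1 hi)
        calc ‖x + (i : ℝ) • y‖ ≤ ‖x‖ + ‖(i : ℝ) • y‖ := norm_add_le _ _
          _ = ‖x‖ + i * ‖y‖ := by rw [norm_smul, Real.norm_of_nonneg (by positivity)]
          _ ≤ N + 1 := by nlinarith [norm_nonneg y]
end
section
open ZeroAtInfty

/-- A null sequence as an element of `c₀`. -/
def c0mk (u : ℕ → ℝ) (h : Tendsto u atTop (𝓝 0)) : C₀(ℕ, ℝ) where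
  toFun := u
  continuous_toFun := continuous_of_discreteTopology
  zero_at_infty' := by
    rw [Filter.cocompact_eq_cofinite, Nat.cofinite_eq_atTop]; exact h

theorem c0mk_apply (u : ℕ → ℝ) (h : Tendsto u atTop (𝓝 0)) (n : ℕ) : c0mk u h n = u n := rfl

theorem c0_norm_le (f : C₀(ℕ, ℝ)) (C : ℝ) (hC : 0 ≤ C) (h : ∀ n, |f n| ≤ C) : ‖f‖ ≤ C := by
  rw [← ZeroAtInftyContinuousMap.norm_toBCF_eq_norm]
  exact (BoundedContinuousFunction.norm_le hC).2 h

theorem c0_le_norm (f : C₀(ℕ, ℝ)) (n : ℕ) : |f n| ≤ ‖f‖ := by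
  rw [← ZeroAtInftyContinuousMap.norm_toBCF_eq_norm]
  exact f.toBCF.norm_coe_le_norm n

theorem c0_tendsto (f : C₀(ℕ, ℝ)) : Tendsto f atTop (𝓝 0) := by
  have := f.zero_at_infty'
  rw [Filter.cocompact_eq_cofinite, Nat.cofinite_eq_atTop] at this
  exact this

/-- Unit vectors of `c₀`. -/
def c0e (n : ℕ) : C₀(ℕ, ℝ) := c0mk (Pi.single n 1) (by
  refine tendsto_const_nhds.congr' ?_
  filter_upwards [eventually_gt_atTop n] with m hm
  rw [Pi.single_eq_of_ne (by omega)])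

theorem c0_sum_apply (v : ℕ → ℝ) (m k : ℕ) :
    (∑ n ∈ Finset.range m, v n • c0e n : C₀(ℕ, ℝ)) k = if k < m then v k else 0 := by
  have h : ∀ s : Finset ℕ, (∑ n ∈ s, v n • c0e n : C₀(ℕ, ℝ)) k = ∑ n ∈ s, v n * (c0e n k) := by
    intro s
    classical
    induction s using Finset.induction_on with
    | empty => simp
    | insert a s ha ih => rw [Finset.sum_insert ha, Finset.sum_insert ha,
        ZeroAtInftyContinuousMap.add_apply, ih, ZeroAtInftyContinuousMap.smul_apply, smul_eq_mul]
  rw [h]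
  simp only [c0e, c0mk_apply, Pi.single_apply, mul_ite, mul_one, mul_zero]
  rw [Finset.sum_ite_eq]
  simp

theorem c0_tendsto_sum (f : C₀(ℕ, ℝ)) :
    Tendsto (fun m => ∑ n ∈ Finset.range m, f n • c0e n) atTop (𝓝 f) := by
  rw [Metric.tendsto_atTop]
  intro ε hε
  obtain ⟨M, hM⟩ := (Metric.tendsto_atTop.1 (c0_tendsto f)) (ε / 2) (by positivity)
  refine ⟨M, fun m hm => ?_⟩
  rw [dist_eq_norm]
  refine lt_of_le_of_lt (c0_norm_le _ (ε / 2) (by positivity) fun k => ?_) (by linarith)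
  rw [ZeroAtInftyContinuousMap.sub_apply, c0_sum_apply]
  split_ifs with hk
  · simp; positivity
  · have := hM k (by omega)
    rw [Real.dist_eq] at this
    simp at this ⊢
    exact this.le

theorem c0_dual_summable (h : C₀(ℕ, ℝ) →L[ℝ] ℝ) : Summable fun n => |h (c0e n)| := by
  refine summable_of_sum_range_le (c := ‖h‖) (fun _ => abs_nonneg _) fun m => ?_
  have h1 : ∑ n ∈ Finset.range m, |h (c0e n)| =
      h (∑ n ∈ Finset.range m, (SignType.sign (h (c0e n)) : ℝ) • c0e n) := by
    rw [map_sum]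
    refine Finset.sum_congr rfl fun n _ => ?_
    rw [map_smul, smul_eq_mul, sign_mul_self]
  rw [h1]
  refine (le_abs_self _).trans ((h.le_opNorm _).trans ?_)
  refine mul_le_of_le_one_right (norm_nonneg _) (c0_norm_le _ 1 zero_le_one fun k => ?_)
  rw [c0_sum_apply (fun n => (SignType.sign (h (c0e n)) : ℝ))]
  split_ifs
  · rcases lt_trichotomy (h (c0e k)) 0 with h | h | h <;> simp [h]
  · simp

theorem dpp_seq {X : Type*} [NormedAddCommGroup X] [NormedSpace ℝ X] (hDP : HasDPP X)
    (F : ℕ → X →L[ℝ] ℝ) (C : ℝ) (hC : ∀ n, ‖F n‖ ≤ C)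
    (hF : ∀ φ : (X →L[ℝ] ℝ) →L[ℝ] ℝ, Tendsto (fun n => φ (F n)) atTop (𝓝 0))
    (y : ℕ → X) (hy : ∀ f : X →L[ℝ] ℝ, Tendsto (fun n => f (y n)) atTop (𝓝 0)) :
    Tendsto (fun n => F n (y n)) atTop (𝓝 0) := by
  have hC0 : 0 ≤ C := (norm_nonneg _).trans (hC 0)
  let S0 : ((X →L[ℝ] ℝ) →L[ℝ] ℝ) →ₗ[ℝ] C₀(ℕ, ℝ) :=
    { toFun := fun φ => c0mk (fun n => φ (F n)) (hF φ)
      map_add' := fun φ ψ => by ext n; rfl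
      map_smul' := fun t φ => by ext n; rfl }
  have hS0 : ∀ φ : (X →L[ℝ] ℝ) →L[ℝ] ℝ, ‖S0 φ‖ ≤ C * ‖φ‖ := by
    intro φ
    refine c0_norm_le _ _ (by positivity) fun n => ?_
    calc |φ (F n)| ≤ ‖φ‖ * ‖F n‖ := φ.le_opNorm _
      _ ≤ ‖φ‖ * C := mul_le_mul_of_nonneg_left (hC n) (norm_nonneg φ)
      _ = C * ‖φ‖ := mul_comm _ _
  let S := LinearMap.mkContinuous (σ := RingHom.id ℝ) (E := (X →L[ℝ] ℝ) →L[ℝ] ℝ) (F := C₀(ℕ, ℝ)) S0 C hS0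
  have hS : ∀ φ n, S φ n = φ (F n) := fun φ n => rfl
  let T : X →L[ℝ] C₀(ℕ, ℝ) := S.comp (NormedSpace.inclusionInDoubleDual ℝ X)
  have hT : ∀ x n, T x n = F n x := fun x n => rfl
  have hdual : ∀ h : C₀(ℕ, ℝ) →L[ℝ] ℝ, ∃ G : X →L[ℝ] ℝ, ∀ φ, h (S φ) = φ G := by
    intro h
    have hsum : Summable fun n => h (c0e n) • F n := by
      refine Summable.of_norm_bounded ((c0_dual_summable h).mul_right C) fun n => ?_
      rw [norm_smul, Real.norm_eq_abs]
      gcongr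
      exact hC n
    refine ⟨∑' n, h (c0e n) • F n, fun φ => ?_⟩
    have h1 := (φ.continuous.tendsto _).comp hsum.hasSum.tendsto_sum_nat
    have h2 := (h.continuous.tendsto _).comp (c0_tendsto_sum (S φ))
    refine tendsto_nhds_unique h2 (h1.congr fun m => ?_)
    simp only [Function.comp, map_sum, map_smul, smul_eq_mul, hS]
    exact Finset.sum_congr rfl fun n _ => mul_comm _ _
  have hwc : ∃ K : Set (WeakSpace ℝ C₀(ℕ, ℝ)), IsCompact K ∧
      ∀ x : X, ‖x‖ ≤ 1 → toWeakSpace ℝ C₀(ℕ, ℝ) (T x) ∈ K := by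
    refine ⟨(fun φ : WeakDual ℝ (X →L[ℝ] ℝ) =>
      toWeakSpace ℝ C₀(ℕ, ℝ) (S (WeakDual.toStrongDual φ))) ''
      (WeakDual.toStrongDual ⁻¹' Metric.closedBall 0 1), ?_, ?_⟩
    · refine (WeakDual.isCompact_closedBall (0 : StrongDual ℝ (X →L[ℝ] ℝ)) 1).image ?_
      refine WeakBilin.continuous_of_continuous_eval _ fun h => ?_
      obtain ⟨G, hG⟩ := hdual h
      have : Continuous fun φ : WeakDual ℝ (X →L[ℝ] ℝ) => φ G := WeakDual.eval_continuous G
      exact this.congr fun φ => (hG (WeakDual.toStrongDual φ)).symm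
    · intro x hx
      refine ⟨StrongDual.toWeakDual (NormedSpace.inclusionInDoubleDual ℝ X x), ?_, rfl⟩
      have hb : NormedSpace.inclusionInDoubleDual ℝ X x ∈
          Metric.closedBall (0 : StrongDual ℝ (StrongDual ℝ X)) 1 := by
        rw [Metric.mem_closedBall,
          dist_zero_right (NormedSpace.inclusionInDoubleDual ℝ X x)]
        exact (NormedSpace.double_dual_bound ℝ X x).trans hx
      exact hb
  have hfin := hDP C₀(ℕ, ℝ) inferInstance inferInstance inferInstance T hwc y 0
    (fun f => by simpa using hy f)
  rw [map_zero] at hfin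
  simp only [sub_zero] at hfin
  refine squeeze_zero_norm (fun n => ?_) hfin
  rw [Real.norm_eq_abs, ← hT]
  exact c0_le_norm _ _
end
section
variable {X : Type*} [NormedAddCommGroup X] [NormedSpace ℝ X]

theorem exists_clm (A : X →ₗ[ℝ] ℝ) (C : ℝ) (hC : 0 ≤ C) (h : ∀ x, ‖x‖ ≤ 1 → |A x| ≤ C) :
    ∃ B : X →L[ℝ] ℝ, (B : X →ₗ[ℝ] ℝ) = A ∧ ‖B‖ ≤ C := by
  have hb : ∀ x, ‖A x‖ ≤ C * ‖x‖ := by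
    intro x
    by_cases hx : x = 0
    · simp [hx]
    · have hx' : 0 < ‖x‖ := norm_pos_iff.2 hx
      have := h (‖x‖⁻¹ • x) (by rw [norm_smul, norm_inv, norm_norm, inv_mul_cancel₀ hx'.ne'])
      rw [map_smul, smul_eq_mul, abs_mul, abs_of_pos (inv_pos.2 hx'), inv_mul_le_iff₀ hx'] at this
      rw [Real.norm_eq_abs]; linarith
  exact ⟨A.mkContinuous C hb, rfl, A.mkContinuous_norm_le hC hb⟩

/-- The partial application of `L` to `ψ · ev_h`. -/
def Dlin (L : ((X →L[ℝ] ℝ) → ℝ) →ₗ[ℝ] ℝ) : ((X →L[ℝ] ℝ) → ℝ) →ₗ[ℝ] (X →ₗ[ℝ] ℝ) :=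
  LinearMap.mk₂ ℝ (fun ψ h => L (ψ * evF h))
    (fun a b h => by rw [add_mul, map_add])
    (fun t a h => by rw [smul_mul_assoc, map_smul])
    (fun a h k => by rw [evF_add, mul_add, map_add])
    (fun t a h => by rw [evF_smul, mul_smul_comm, map_smul])

theorem Dlin_apply (L : ((X →L[ℝ] ℝ) → ℝ) →ₗ[ℝ] ℝ) (ψ : (X →L[ℝ] ℝ) → ℝ) (h : X) :
    Dlin L ψ h = L (ψ * evF h) := rfl

theorem weak_null_poly (hDP : HasDPP X) (y : ℕ → X) (hy1 : ∀ n, ‖y n‖ ≤ 1)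
    (hy : ∀ f : X →L[ℝ] ℝ, Tendsto (fun n => f (y n)) atTop (𝓝 0)) (N : ℕ) :
    ∀ (L : ((X →L[ℝ] ℝ) → ℝ) →ₗ[ℝ] ℝ) (C : ℝ),
      (∀ x : X, ‖x‖ ≤ 1 → |L (evF x ^ (N + 1))| ≤ C) →
      Tendsto (fun n => L (evF (y n) ^ (N + 1))) atTop (𝓝 0) := by
  induction N with
  | zero =>
    intro L C hL
    have hC : 0 ≤ C := (abs_nonneg _).trans (hL 0 (by simp))
    obtain ⟨B, hB, _⟩ := exists_clm (Dlin L 1) C hC (fun x hx => by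
      rw [Dlin_apply]; simpa using hL x hx)
    refine (hy B).congr fun n => ?_
    have : B (y n) = Dlin L 1 (y n) := by rw [← hB]; rfl
    rw [this, Dlin_apply]; simp
  | succ N ih =>
    intro L C hL
    obtain ⟨C', hC', hb⟩ := mixed_bound L (N + 1 + 1) C hL 1 (by omega)
    have hb' : ∀ x y : X, ‖x‖ ≤ 1 → ‖y‖ ≤ 1 → |L (evF x ^ (N + 1) * evF y)| ≤ C' := by
      simpa using hb
    obtain ⟨r, hr⟩ := LinearMap.exists_leftInverse_of_injective
      (ContinuousLinearMap.coeLM ℝ : (X →L[ℝ] ℝ) →ₗ[ℝ] (X →ₗ[ℝ] ℝ))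
      (LinearMap.ker_eq_bot.2 ContinuousLinearMap.coe_injective)
    have hD : ∀ x : X, ‖x‖ ≤ 1 → ‖r (Dlin L (evF x ^ (N + 1)))‖ ≤ C' ∧
        ∀ h, r (Dlin L (evF x ^ (N + 1))) h = L (evF x ^ (N + 1) * evF h) := by
      intro x hx
      obtain ⟨B, hB, hBn⟩ := exists_clm (Dlin L (evF x ^ (N + 1))) C' hC' (fun h hh => by
        rw [Dlin_apply]; exact hb' x h hx hh)
      have h1 : r (Dlin L (evF x ^ (N + 1))) = B := by
        rw [← hB]
        exact LinearMap.congr_fun hr B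
      rw [h1]
      refine ⟨hBn, fun h => ?_⟩
      rw [← Dlin_apply, ← hB]; rfl
    have key := dpp_seq hDP (fun n => r (Dlin L (evF (y n) ^ (N + 1)))) C'
      (fun n => (hD _ (hy1 n)).1) (fun φ => ?_) y hy
    · refine key.congr fun n => ?_
      rw [(hD _ (hy1 n)).2, ← pow_succ]
    · refine ih ((φ : (X →L[ℝ] ℝ) →ₗ[ℝ] ℝ) ∘ₗ r ∘ₗ Dlin L) (‖φ‖ * C') fun x hx => ?_
      refine (φ.le_opNorm _).trans ?_
      exact mul_le_mul_of_nonneg_left (hD x hx).1 (norm_nonneg _)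

theorem poly_tendsto (hDP : HasDPP X) (y : ℕ → X) (hy1 : ∀ n, ‖y n‖ ≤ 1)
    (hy : ∀ f : X →L[ℝ] ℝ, Tendsto (fun n => f (y n)) atTop (𝓝 0)) (N : ℕ)
    (L : ((X →L[ℝ] ℝ) → ℝ) →ₗ[ℝ] ℝ) (C : ℝ)
    (hL : ∀ x : X, ‖x‖ ≤ 1 → |L (evF x ^ N)| ≤ C) (x : X) (hx : ‖x‖ ≤ 1) :
    Tendsto (fun n => L (evF (x + y n) ^ N)) atTop (𝓝 (L (evF x ^ N))) := by
  have h1 : ∀ n, L (evF (x + y n) ^ N) = ∑ k ∈ Finset.range (N + 1),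
      ((N.choose k : ℝ) * L (evF x ^ (N - k) * evF (y n) ^ k)) := by
    intro n
    have := L_expand L N 1 x (y n)
    simpa using this
  simp_rw [h1]
  have h2 : L (evF x ^ N) = ∑ k ∈ Finset.range (N + 1), if k = 0 then L (evF x ^ N) else 0 := by
    simp
  rw [h2]
  refine tendsto_finsetSum _ fun k hk => ?_
  split_ifs with h0
  · subst h0; simp
  · obtain ⟨j, rfl⟩ := Nat.exists_eq_succ_of_ne_zero h0
    have hj : j + 1 ≤ N := Nat.lt_succ_iff.1 (Finset.mem_range.1 hk)
    obtain ⟨C', hC', hb⟩ := mixed_bound L N C hL (j + 1) hj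
    have := weak_null_poly hDP y hy1 hy j
      (L ∘ₗ LinearMap.mulLeft ℝ (evF x ^ (N - (j + 1)))) C' (fun z hz => hb x z hx hz)
    simpa using this.const_mul (N.choose (j + 1) : ℝ)

theorem exists_L_mixed (N : ℕ) (hN : 1 ≤ N) (f h : X →L[ℝ] ℝ) :
    ∃ L : ((X →L[ℝ] ℝ) → ℝ) →ₗ[ℝ] ℝ, ∀ x : X, L (evF x ^ N) = f x ^ (N - 1) * h x := by
  obtain ⟨c, hc⟩ := exists_coeffs N
  refine ⟨(N : ℝ)⁻¹ • ∑ i ∈ Finset.range (N + 1),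
    c 1 i • (LinearMap.proj (f + (i : ℝ) • h) : ((X →L[ℝ] ℝ) → ℝ) →ₗ[ℝ] ℝ), fun x => ?_⟩
  have key := hc (fun k => (N.choose k : ℝ) * (f x ^ (N - k) * h x ^ k)) 1
    (Finset.mem_range.2 (by omega))
  have hN' : (N : ℝ) ≠ 0 := by positivity
  simp only [Nat.choose_one_right, pow_one] at key
  rw [LinearMap.smul_apply, LinearMap.sum_apply, smul_eq_mul, inv_mul_eq_iff_eq_mul₀ hN', ← key]
  refine Finset.sum_congr rfl fun i _ => ?_
  rw [LinearMap.smul_apply, smul_eq_mul]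
  congr 1
  simp only [LinearMap.proj_apply, Pi.pow_apply, evF, add_apply,
    smul_apply, smul_eq_mul]
  rw [add_comm, add_pow]
  refine Finset.sum_congr rfl fun k _ => ?_
  ring
end
section
set_option linter.unusedSectionVars false
variable {X : Type*} [NormedAddCommGroup X] [NormedSpace ℝ X] {N : ℕ}
  {Z : Type*} [NormedAddCommGroup Z] [NormedSpace ℝ Z] {δ : X → Z}

theorem list_L (L : ((X →L[ℝ] ℝ) → ℝ) →ₗ[ℝ] ℝ) (N : ℕ) (l : List (ℝ × X)) :
    (l.map fun p => p.1 * L (evF p.2 ^ N)).sum = L (fun f => (l.map fun p => p.1 * (f p.2) ^ N).sum) := by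
  induction l with
  | nil => exact (map_zero L).symm
  | cons p l ih =>
    simp only [List.map_cons, List.sum_cons]
    rw [ih]
    have : (fun f : X →L[ℝ] ℝ => p.1 * f p.2 ^ N + (l.map fun p => p.1 * (f p.2) ^ N).sum)
      = p.1 • evF p.2 ^ N + fun f : X →L[ℝ] ℝ => (l.map fun p => p.1 * (f p.2) ^ N).sum := rfl
    rw [this, map_add, map_smul, smul_eq_mul]

theorem list_abs_le (q : X → ℝ) (N : ℕ) (C : ℝ) (hq : ∀ x, |q x| ≤ C * ‖x‖ ^ N)
    (l : List (ℝ × X)) :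
    |(l.map fun p => p.1 * q p.2).sum| ≤ C * (l.map fun p => |p.1| * ‖p.2‖ ^ N).sum := by
  induction l with
  | nil => simp
  | cons p l ih =>
    simp only [List.map_cons, List.sum_cons]
    refine (abs_add_le _ _).trans ?_
    rw [mul_add, abs_mul]
    have := mul_le_mul_of_nonneg_left (hq p.2) (abs_nonneg p.1)
    linarith

theorem list_nonneg (N : ℕ) (l : List (ℝ × X)) :
    0 ≤ (l.map fun p => |p.1| * ‖p.2‖ ^ N).sum := by
  refine List.sum_nonneg fun a ha => ?_
  obtain ⟨p, _, rfl⟩ := List.mem_map.1 ha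
  positivity

theorem proj_le (hδ : IsProjSymTensorProduct X N Z δ) (l l' : List (ℝ × X))
    (h : ∀ f : X →L[ℝ] ℝ,
      (l'.map fun p => p.1 * (f p.2) ^ N).sum = (l.map fun p => p.1 * (f p.2) ^ N).sum) :
    ‖(l.map fun p => p.1 • δ p.2).sum‖ ≤ (l'.map fun p => |p.1| * ‖p.2‖ ^ N).sum := by
  rw [hδ.2 l]
  refine csInf_le ⟨0, ?_⟩ ⟨l', h, rfl⟩
  rintro s ⟨m, _, rfl⟩
  exact list_nonneg N m

theorem norm_delta_le (hδ : IsProjSymTensorProduct X N Z δ) (x : X) : ‖δ x‖ ≤ ‖x‖ ^ N := by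
  simpa using proj_le hδ [(1, x)] [(1, x)] (fun _ => rfl)

theorem proj_bound (hδ : IsProjSymTensorProduct X N Z δ)
    (L : ((X →L[ℝ] ℝ) → ℝ) →ₗ[ℝ] ℝ) (C : ℝ) (hC : 0 ≤ C)
    (hL : ∀ x : X, |L (evF x ^ N)| ≤ C * ‖x‖ ^ N) (l : List (ℝ × X)) :
    |(l.map fun p => p.1 * L (evF p.2 ^ N)).sum| ≤ C * ‖(l.map fun p => p.1 • δ p.2).sum‖ := by
  have h1 : ∀ l' : List (ℝ × X), (∀ f : X →L[ℝ] ℝ,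
      (l'.map fun p => p.1 * (f p.2) ^ N).sum = (l.map fun p => p.1 * (f p.2) ^ N).sum) →
      |(l.map fun p => p.1 * L (evF p.2 ^ N)).sum| ≤
        C * (l'.map fun p => |p.1| * ‖p.2‖ ^ N).sum := by
    intro l' h
    have h2 : (l.map fun p => p.1 * L (evF p.2 ^ N)).sum =
        (l'.map fun p => p.1 * L (evF p.2 ^ N)).sum := by
      rw [list_L, list_L]; congr 1; funext f; exact (h f).symm
    rw [h2]
    exact list_abs_le (fun x => L (evF x ^ N)) N C hL l'
  rcases hC.eq_or_lt with h0 | h0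
  · have := h1 l (fun _ => rfl)
    rw [← h0] at this ⊢
    simpa using this
  · rw [hδ.2 l, ← div_le_iff₀' h0]
    refine le_csInf ⟨_, l, fun _ => rfl, rfl⟩ ?_
    rintro s ⟨l', h, rfl⟩
    rw [div_le_iff₀' h0]
    exact h1 l' h

/-- A list representing a finitely supported function. -/
noncomputable def fsList (l : X →₀ ℝ) : List (ℝ × X) := l.support.toList.map fun x => (l x, x)

theorem fsList_sum {M : Type*} [AddCommGroup M] [Module ℝ M] (v : X → M) (l : X →₀ ℝ) :
    Finsupp.linearCombination ℝ v l = ((fsList l).map fun p => p.1 • v p.2).sum := by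
  rw [Finsupp.linearCombination_apply, Finsupp.sum, fsList, List.map_map]
  exact (Finset.sum_map_toList l.support _).symm

theorem exists_factor {A B : Type*} [AddCommGroup A] [Module ℝ A] [AddCommGroup B] [Module ℝ B]
    (T : A →ₗ[ℝ] B) (q : A →ₗ[ℝ] ℝ) (h : ∀ a, T a = 0 → q a = 0) :
    ∃ L : B →ₗ[ℝ] ℝ, ∀ a, L (T a) = q a := by
  have hq : q ∈ (LinearMap.ker T).dualAnnihilator := by
    rw [Submodule.mem_dualAnnihilator]
    exact fun a ha => h a ha
  rw [← LinearMap.range_dualMap_eq_dualAnnihilator_ker] at hq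
  obtain ⟨L, hL⟩ := hq
  exact ⟨L, fun a => by rw [← hL]; rfl⟩

theorem exists_L (hδ : IsProjSymTensorProduct X N Z δ) (g : Z →L[ℝ] ℝ) :
    ∃ L : ((X →L[ℝ] ℝ) → ℝ) →ₗ[ℝ] ℝ, ∀ x, L (evF x ^ N) = g (δ x) := by
  obtain ⟨L, hL⟩ := exists_factor (Finsupp.linearCombination ℝ fun x : X => evF x ^ N)
    ((g : Z →ₗ[ℝ] ℝ) ∘ₗ Finsupp.linearCombination ℝ δ) (fun l hl => by
      have : Finsupp.linearCombination ℝ δ l = 0 := by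
        rw [← norm_le_zero_iff, fsList_sum]
        refine proj_le hδ (fsList l) [] fun f => ?_
        have h2 : Finsupp.linearCombination ℝ (fun x : X => f x ^ N) l = 0 := by
          have := congrFun hl f
          rw [Finsupp.linearCombination_apply, Finsupp.sum] at this ⊢
          rw [Finset.sum_apply] at this
          exact this
        rw [fsList_sum] at h2
        exact h2.symm
      simp [this])
  refine ⟨L, fun x => ?_⟩
  simpa using hL (Finsupp.single x 1)

theorem exists_functional (hδ : IsProjSymTensorProduct X N Z δ)
    (L : ((X →L[ℝ] ℝ) → ℝ) →ₗ[ℝ] ℝ) (C : ℝ) (hC : 0 ≤ C)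
    (hL : ∀ x : X, |L (evF x ^ N)| ≤ C * ‖x‖ ^ N) :
    ∃ Q : Z →L[ℝ] ℝ, ‖Q‖ ≤ C ∧ ∀ x, Q (δ x) = L (evF x ^ N) := by
  set S := Finsupp.linearCombination ℝ δ with hS
  set q := Finsupp.linearCombination ℝ (fun x : X => L (evF x ^ N)) with hq
  have hb : ∀ l, |q l| ≤ C * ‖S l‖ := by
    intro l
    rw [hq, hS, fsList_sum, fsList_sum]
    exact proj_bound hδ L C hC hL (fsList l)
  obtain ⟨Q0, hQ0⟩ := exists_factor S q (fun l hl => by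
    have := hb l
    rw [hl, norm_zero, mul_zero] at this
    exact abs_nonpos_iff.1 this)
  have hb2 : ∀ z : LinearMap.range S, ‖(Q0 ∘ₗ (LinearMap.range S).subtype) z‖ ≤ C * ‖z‖ := by
    rintro ⟨_, l, rfl⟩
    have : (Q0 ∘ₗ (LinearMap.range S).subtype) ⟨S l, l, rfl⟩ = q l := hQ0 l
    rw [this]
    exact hb l
  obtain ⟨Q, hQ, hQn⟩ := exists_extension_norm_eq (LinearMap.range S)
    ((Q0 ∘ₗ (LinearMap.range S).subtype).mkContinuous C hb2)
  refine ⟨Q, hQn.le.trans (LinearMap.mkContinuous_norm_le _ hC hb2), fun x => ?_⟩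
  have h1 : S (Finsupp.single x 1) = δ x := by simp [hS]
  have h2 := hQ ⟨δ x, Finsupp.single x 1, h1⟩
  rw [h2]
  have h3 := hQ0 (Finsupp.single x 1)
  rw [h1] at h3
  refine h3.trans ?_
  simp [hq]

theorem exists_near (hδ : IsProjSymTensorProduct X N Z δ) (hN : 1 ≤ N) (g : Z →L[ℝ] ℝ)
    (hg : ‖g‖ = 1) (ε : ℝ) (hε : 0 < ε) : ∃ x : X, ‖x‖ = 1 ∧ 1 - ε < |g (δ x)| := by
  by_contra hcon
  push Not at hcon
  obtain ⟨L, hL⟩ := exists_L hδ g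
  set C := max 0 (1 - ε) with hCdef
  have hC : 0 ≤ C := le_max_left _ _
  have hC1 : C < 1 := max_lt one_pos (by linarith)
  have hb : ∀ x : X, |L (evF x ^ N)| ≤ C * ‖x‖ ^ N := by
    intro x
    by_cases hx : x = 0
    · have h0 := L_smul L N 0 x
      rw [zero_smul, zero_pow (by omega), zero_mul] at h0
      rw [hx, h0, abs_zero]
      positivity
    · have hx' : 0 < ‖x‖ := norm_pos_iff.2 hx
      have h1 := hcon (‖x‖⁻¹ • x) (by rw [norm_smul, norm_inv, norm_norm, inv_mul_cancel₀ hx'.ne'])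
      have h2 : x = ‖x‖ • (‖x‖⁻¹ • x) := by rw [smul_smul, mul_inv_cancel₀ hx'.ne', one_smul]
      rw [← hL] at h1
      have h3 := L_smul L N ‖x‖ (‖x‖⁻¹ • x)
      rw [← h2] at h3
      rw [h3, abs_mul, abs_of_nonneg (by positivity : 0 ≤ ‖x‖ ^ N), mul_comm]
      gcongr
      exact h1.trans (le_max_right _ _)
  have hall : ∀ z : Z, ‖g z‖ ≤ C * ‖z‖ := by
    have hcl : IsClosed {z : Z | ‖g z‖ ≤ C * ‖z‖} :=
      isClosed_le (by fun_prop) (by fun_prop)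
    have hsub : (Submodule.span ℝ (Set.range δ) : Set Z) ⊆ {z : Z | ‖g z‖ ≤ C * ‖z‖} := by
      intro z hz
      rw [SetLike.mem_coe, ← Finsupp.range_linearCombination] at hz
      obtain ⟨l, rfl⟩ := hz
      have h1 := proj_bound hδ L C hC hb (fsList l)
      have h2 : g (Finsupp.linearCombination ℝ δ l) =
          Finsupp.linearCombination ℝ (fun x : X => L (evF x ^ N)) l := by
        simp [Finsupp.linearCombination_apply, Finsupp.sum, hL]
      rw [Set.mem_ofPred_eq, h2, fsList_sum, fsList_sum]
      exact h1
    intro z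
    have hz : z ∈ (Submodule.span ℝ (Set.range δ)).topologicalClosure := by
      rw [hδ.1]; trivial
    exact closure_minimal hsub hcl hz
  have := g.opNorm_le_bound hC hall
  linarith
end
theorem core_fact {X : Type*} [NormedAddCommGroup X] [NormedSpace ℝ X]
    (hDP : HasDPP X) (hX : IsWASQ X) {N : ℕ} (hN : 1 ≤ N)
    {Z : Type*} [NormedAddCommGroup Z] [NormedSpace ℝ Z]
    {δ : X → Z} (hδ : IsProjSymTensorProduct X N Z δ)
    (g : Z →L[ℝ] ℝ) (hg : ‖g‖ = 1) (ε : ℝ) (hε : 0 < ε) :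
    ∃ (u v : Z) (Q : Z →L[ℝ] ℝ), ‖u‖ ≤ 1 ∧ ‖v‖ ≤ 1 ∧ 1 - ε < g u ∧ 1 - ε < g v ∧
      ‖Q‖ ≤ 1 ∧ 1 - ε < Q u ∧ Q v < -(1 - ε) := by
  obtain ⟨x, hx, hgx⟩ := exists_near hδ hN g hg ε hε
  obtain ⟨s, hs, hsg⟩ : ∃ s : ℝ, |s| = 1 ∧ s * g (δ x) = |g (δ x)| := by
    rcases le_total 0 (g (δ x)) with h | h
    · exact ⟨1, by simp, by rw [abs_of_nonneg h, one_mul]⟩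
    · exact ⟨-1, by simp, by rw [abs_of_nonpos h]; ring⟩
  have hss : s * s = 1 := by rw [← abs_mul_abs_self, hs, one_mul]
  obtain ⟨w, hw1, hwn, hwp, hwm, hw0⟩ := hX x hx
  obtain ⟨L, hL⟩ := exists_L hδ g
  have hLb : ∀ z : X, ‖z‖ ≤ 1 → |L (evF z ^ N)| ≤ 1 := by
    intro z hz
    rw [hL]
    refine (g.le_opNorm _).trans ?_
    rw [hg, one_mul]
    exact (norm_delta_le hδ z).trans (pow_le_one₀ (norm_nonneg _) hz)
  have hPp : Tendsto (fun n => g (δ (x + w n))) atTop (𝓝 (g (δ x))) := by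
    have := poly_tendsto hDP w hw1 hw0 N L 1 hLb x hx.le
    simpa only [hL] using this
  have hPm : Tendsto (fun n => g (δ (x - w n))) atTop (𝓝 (g (δ x))) := by
    have := poly_tendsto hDP (fun n => -w n) (fun n => by rw [norm_neg]; exact hw1 n)
      (fun f => by simpa using (hw0 f).neg) N L 1 hLb x hx.le
    simpa only [hL, ← sub_eq_add_neg] using this
  obtain ⟨f, hf1, hfx⟩ := exists_dual_vector'' ℝ x
  have hfx : f x = 1 := by rw [hfx, hx]; rfl
  have hh : ∀ n, ∃ h : X →L[ℝ] ℝ, ‖h‖ ≤ 1 ∧ h (w n) = ‖w n‖ := fun n => by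
    obtain ⟨h, h1, h2⟩ := exists_dual_vector'' ℝ (w n)
    exact ⟨h, h1, h2⟩
  choose h hh1 hhw using hh
  have hhx : Tendsto (fun n => h n x) atTop (𝓝 0) := by
    have hle : ∀ n (z : X), h n z ≤ ‖z‖ := fun n z =>
      (le_abs_self _).trans (((h n).le_opNorm z).trans
        (mul_le_of_le_one_left (norm_nonneg _) (hh1 n)))
    refine tendsto_of_tendsto_of_tendsto_of_le_of_le (g := fun n => ‖w n‖ - ‖x - w n‖)
      (h := fun n => ‖x + w n‖ - ‖w n‖) ?_ ?_ (fun n => ?_) (fun n => ?_)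
    · simpa using hwn.sub hwm
    · simpa using hwp.sub hwn
    · have := hle n (-(x - w n))
      rw [norm_neg, map_neg, map_sub, hhw] at this
      show ‖w n‖ - ‖x - w n‖ ≤ h n x
      linarith
    · have := hle n (x + w n)
      rw [map_add, hhw] at this
      show h n x ≤ ‖x + w n‖ - ‖w n‖
      linarith
  have hQ : ∀ n, ∃ Q : Z →L[ℝ] ℝ, ‖Q‖ ≤ 1 ∧ ∀ z, Q (δ z) = f z ^ (N - 1) * h n z := by
    intro n
    obtain ⟨L', hL'⟩ := exists_L_mixed N hN f (h n)
    obtain ⟨Q, hQ1, hQ2⟩ := exists_functional hδ L' 1 zero_le_one (fun z => by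
      rw [hL', abs_mul, abs_pow, one_mul]
      have h1 : |f z| ≤ ‖z‖ :=
        (f.le_opNorm z).trans (mul_le_of_le_one_left (norm_nonneg _) hf1)
      have h2 : |h n z| ≤ ‖z‖ :=
        ((h n).le_opNorm z).trans (mul_le_of_le_one_left (norm_nonneg _) (hh1 n))
      calc |f z| ^ (N - 1) * |h n z| ≤ ‖z‖ ^ (N - 1) * ‖z‖ := by gcongr
        _ = ‖z‖ ^ N := by rw [← pow_succ, Nat.sub_add_cancel hN])
    exact ⟨Q, hQ1, fun z => by rw [hQ2, hL']⟩
  choose Q hQ1 hQ2 using hQ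
  set c : ℕ → ℝ := fun n => max 1 (max ‖x + w n‖ ‖x - w n‖) with hc
  have hc1 : ∀ n, 1 ≤ c n := fun n => le_max_left _ _
  have hct : Tendsto c atTop (𝓝 1) := by
    simpa using (tendsto_const_nhds (x := (1 : ℝ))).max (hwp.max hwm)
  have hcN : Tendsto (fun n => (c n ^ N)⁻¹) atTop (𝓝 1) := by
    simpa using (hct.pow N).inv₀ (by simp)
  have hball : ∀ n (z : X), ‖z‖ ≤ c n → ‖(s * (c n ^ N)⁻¹) • δ z‖ ≤ 1 := by
    intro n z hz
    have hp : 0 < c n ^ N := pow_pos (one_pos.trans_le (hc1 n)) N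
    rw [norm_smul, norm_mul, Real.norm_eq_abs, hs, one_mul, norm_inv,
      Real.norm_of_nonneg hp.le, inv_mul_le_iff₀ hp, mul_one]
    exact (norm_delta_le hδ z).trans (by gcongr)
  have t1 : Tendsto (fun n => g ((s * (c n ^ N)⁻¹) • δ (x + w n))) atTop (𝓝 |g (δ x)|) := by
    have := (hcN.const_mul s).mul hPp
    rw [mul_one, hsg] at this
    simpa using this
  have t2 : Tendsto (fun n => g ((s * (c n ^ N)⁻¹) • δ (x - w n))) atTop (𝓝 |g (δ x)|) := by
    have := (hcN.const_mul s).mul hPm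
    rw [mul_one, hsg] at this
    simpa using this
  have hsimp : ∀ n z, (s • Q n) ((s * (c n ^ N)⁻¹) • δ z) =
      (c n ^ N)⁻¹ * (f z ^ (N - 1) * h n z) := by
    intro n z
    have : (s • Q n) ((s * (c n ^ N)⁻¹) • δ z) = (s * s) * ((c n ^ N)⁻¹ * Q n (δ z)) := by
      simp
      ring
    rw [this, hQ2, hss, one_mul]
  have t3 : Tendsto (fun n => (s • Q n) ((s * (c n ^ N)⁻¹) • δ (x + w n))) atTop (𝓝 1) := by
    simp_rw [hsimp, map_add, hhw, hfx]
    simpa using hcN.mul ((((hw0 f).const_add 1).pow (N - 1)).mul (hhx.add hwn))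
  have t4 : Tendsto (fun n => (s • Q n) ((s * (c n ^ N)⁻¹) • δ (x - w n))) atTop (𝓝 (-1)) := by
    simp_rw [hsimp, map_sub, hhw, hfx]
    simpa using hcN.mul ((((hw0 f).const_sub 1).pow (N - 1)).mul (hhx.sub hwn))
  obtain ⟨n, e1, e2, e3, e4⟩ := ((t1.eventually_const_lt hgx).and
    ((t2.eventually_const_lt hgx).and ((t3.eventually_const_lt (by linarith : 1 - ε < 1)).and
      (t4.eventually_lt_const (by linarith : (-1 : ℝ) < -(1 - ε)))))).exists
  refine ⟨_, _, s • Q n, hball n (x + w n) ?_, hball n (x - w n) ?_, e1, e2, ?_, e3, e4⟩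
  · exact (le_max_left _ _).trans (le_max_right _ _)
  · exact (le_max_right _ _).trans (le_max_right _ _)
  · rw [norm_smul, Real.norm_eq_abs, hs, one_mul]; exact hQ1 n

theorem statement13 (X : Type*) [NormedAddCommGroup X] [NormedSpace ℝ X] [CompleteSpace X]
    (hDP : HasDPP X) (hX : IsWASQ X) (N : ℕ) (hN : 1 ≤ N)
    (Z : Type*) [NormedAddCommGroup Z] [NormedSpace ℝ Z] [CompleteSpace Z]
    (δ : X → Z) (hδ : IsProjSymTensorProduct X N Z δ) :
    IsLocallyOctahedral (Z →L[ℝ] ℝ) ∧ HasLD2P Z := by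
  have hle : ∀ (G : Z →L[ℝ] ℝ) (z : Z), ‖z‖ ≤ 1 → G z ≤ ‖G‖ := fun G z hz =>
    (le_abs_self _).trans ((G.le_opNorm z).trans (mul_le_of_le_one_right (norm_nonneg G) hz))
  constructor
  · intro g hg ε hε
    obtain ⟨u, v, Q, hu, hv, hgu, hgv, hQ, hQu, hQv⟩ :=
      core_fact hDP hX hN hδ g hg (min (ε / 2) (1 / 2)) (by positivity)
    have m1 := min_le_left (ε / 2) (1 / 2)
    have m2 := min_le_right (ε / 2) (1 / 2)
    have hQpos : 0 < ‖Q‖ := by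
      have := hle Q u hu
      linarith
    have hinv : 1 ≤ ‖Q‖⁻¹ := (one_le_inv₀ hQpos).2 hQ
    refine ⟨‖Q‖⁻¹ • Q, ?_, ?_, ?_⟩
    · rw [norm_smul, norm_inv, norm_norm, inv_mul_cancel₀ hQpos.ne']
    · have h1 := hle (g + ‖Q‖⁻¹ • Q) u hu
      have h2 : (g + ‖Q‖⁻¹ • Q) u = g u + ‖Q‖⁻¹ * Q u := rfl
      rw [h2] at h1
      nlinarith
    · have h1 := hle (g - ‖Q‖⁻¹ • Q) v hv
      have h2 : (g - ‖Q‖⁻¹ • Q) v = g v - ‖Q‖⁻¹ * Q v := rfl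
      rw [h2] at h1
      nlinarith
  · intro g hg α hα
    have hbdd : Bornology.IsBounded {x : Z | ‖x‖ ≤ 1 ∧ 1 - α < g x} :=
      (Metric.isBounded_closedBall (x := (0 : Z)) (r := 1)).subset fun x hx => by
        simpa using hx.1
    apply le_antisymm
    · refine Metric.diam_le_of_forall_dist_le (by norm_num) fun x hx y hy => ?_
      rw [dist_eq_norm]
      have := norm_sub_le x y
      linarith [hx.1, hy.1]
    · refine le_of_forall_pos_le_add fun ε hε => ?_
      obtain ⟨u, v, Q, hu, hv, hgu, hgv, hQ, hQu, hQv⟩ :=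
        core_fact hDP hX hN hδ g hg (min (ε / 2) α) (by positivity)
      have m1 := min_le_left (ε / 2) α
      have m2 := min_le_right (ε / 2) α
      have hd := Metric.dist_le_diam_of_mem hbdd (x := u) (y := v)
        ⟨hu, by linarith⟩ ⟨hv, by linarith⟩
      rw [dist_eq_norm] at hd
      have h1 : Q (u - v) ≤ ‖u - v‖ :=
        (le_abs_self _).trans ((Q.le_opNorm _).trans (mul_le_of_le_one_left (norm_nonneg _) hQ))
      rw [map_sub] at h1
      linarith
end
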